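/- A hypersemigroup (H, ∘) is intra-regular if and only if for every right ideal A of H and every left ideal B of H, A ∩ B ⊆ B*A. -/

import Mathlib

/-- The product of subsets of a hypergroupoid: `A*B := ⋃_{(a,b) ∈ A×B} a∘b`. -/
def hProd {H : Type*} (circ : H → H → Set H) (A B : Set H) : Set H :=
  ⋃ a ∈ A, ⋃ b ∈ B, circ a b

theorem mem_hProd {H : Type*} {circ : H → H → Set H} {A B : Set H} {t : H} :
    t ∈ hProd circ A B ↔ ∃ a ∈ A, ∃ b ∈ B, t ∈ circ a b := by
  simp [hProd]

/-- Theorem 22: a hypersemigroup is intra-regular iff `A ∩ B ⊆ B*A` for every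
right ideal `A` and every left ideal `B`. -/
theorem intraRegular_iff_inter_subset {H : Type*} [Nonempty H]
    (circ : H → H → Set H) (hcirc : ∀ a b : H, (circ a b).Nonempty)
    (assoc : ∀ x y z : H, hProd circ {x} (circ y z) = hProd circ (circ x y) {z}) :
    (∀ a : H, ∃ x y : H,
        a ∈ hProd circ (hProd circ (hProd circ {x} {a}) {a}) {y}) ↔
      (∀ A B : Set H, A.Nonempty → B.Nonempty →
        hProd circ A Set.univ ⊆ A → hProd circ Set.univ B ⊆ B →
        A ∩ B ⊆ hProd circ B A) := by
  have assoc_left : ∀ {x y z u t : H}, u ∈ circ y z → t ∈ circ x u →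
      ∃ v ∈ circ x y, t ∈ circ v z := by
    intro x y z u t hu ht
    have h : t ∈ hProd circ (circ x y) {z} := by
      rw [← assoc]
      exact mem_hProd.2 ⟨x, rfl, u, hu, ht⟩
    obtain ⟨v, hv, _, rfl, htv⟩ := mem_hProd.1 h
    exact ⟨v, hv, htv⟩
  have assoc_right : ∀ {x y z v t : H}, v ∈ circ x y → t ∈ circ v z →
      ∃ u ∈ circ y z, t ∈ circ x u := by
    intro x y z v t hv ht
    have h : t ∈ hProd circ {x} (circ y z) := by
      rw [assoc]
      exact mem_hProd.2 ⟨v, hv, z, rfl, ht⟩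
    obtain ⟨_, rfl, u, hu, htu⟩ := mem_hProd.1 h
    exact ⟨u, hu, htu⟩
  have mem_iff : ∀ {a x y : H},
      a ∈ hProd circ (hProd circ (hProd circ {x} {a}) {a}) {y} ↔
        ∃ r ∈ circ x a, ∃ q ∈ circ r a, a ∈ circ q y := by
    intro a x y
    simp [mem_hProd]
    grind
  simp only [mem_iff]
  constructor
  · rintro h A B - - hA hB a ⟨haA, haB⟩
    obtain ⟨x, y, r, hr, q, hq, ha⟩ := h a
    obtain ⟨u, hu, hau⟩ := assoc_right hq ha
    exact mem_hProd.2 ⟨r, hB (mem_hProd.2 ⟨x, trivial, a, haB, hr⟩),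
      u, hA (mem_hProd.2 ⟨a, haA, y, trivial, hu⟩), hau⟩
  · intro h a
    have key := @h {t | t = a ∨ ∃ k, t ∈ circ a k} {t | t = a ∨ ∃ k, t ∈ circ k a}
      ⟨a, .inl rfl⟩ ⟨a, .inl rfl⟩ ?_ ?_ a ⟨.inl rfl, .inl rfl⟩
    · obtain ⟨u, hu, v, hv, ha⟩ := mem_hProd.1 key
      rcases hu with rfl | ⟨k, hu⟩ <;> rcases hv with rfl | ⟨l, hv⟩
      · exact ⟨_, _, _, ha, _, ha, ha⟩
      · obtain ⟨p, hp, hap⟩ := assoc_left hv ha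
        obtain ⟨q, hq, hpq⟩ := assoc_left hap hp
        obtain ⟨y, -, hy⟩ := assoc_right hpq hap
        obtain ⟨r, hr, hqr⟩ := assoc_left hp hq
        exact ⟨_, y, r, hr, q, hqr, hy⟩
      · obtain ⟨s, hs, hus⟩ := assoc_left ha hu
        obtain ⟨x, -, hx⟩ := assoc_left hu hs
        exact ⟨x, _, s, hx, u, hus, ha⟩
      · obtain ⟨q, hq, haq⟩ := assoc_left hv ha
        exact ⟨k, l, u, hu, q, hq, haq⟩
    · intro t ht
      obtain ⟨u, rfl | ⟨k, hu⟩, v, -, ht⟩ := mem_hProd.1 ht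
      · exact .inr ⟨v, ht⟩
      · obtain ⟨w, -, hw⟩ := assoc_right hu ht
        exact .inr ⟨w, hw⟩
    · intro t ht
      obtain ⟨u, -, v, rfl | ⟨k, hv⟩, htv⟩ := mem_hProd.1 ht
      · exact .inr ⟨u, htv⟩
      · obtain ⟨w, -, hw⟩ := assoc_left hv htv
        exact .inr ⟨w, hw⟩
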